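/- Let C ⊂ 𝔸ⁿ be an affine algebraic curve defined over a number field K, S a finite set of places of K containing all infinite places, and O_S the ring of S-integers. Suppose C has exactly two points at infinity A and B, which are conjugate over K, with field of definition L = K(A) = K(B), a quadratic extension of K. If the set C(O_S) of S-integral points is infinite, then at least one place v ∈ S splits in L. -/

import Mathlib

open IsDedekindDomain NumberField

set_option synthInstance.maxHeartbeats 1000000
set_option maxHeartbeats 2000000

noncomputable section

/-- A place of a number field `K`: either an infinite (archimedean) place or a finite
place, i.e. a height-one prime of the ring of integers. -/
abbrev NFPlace (K : Type) [Field K] [NumberField K] :=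
  NumberField.InfinitePlace K ⊕ IsDedekindDomain.HeightOneSpectrum (NumberField.RingOfIntegers K)

variable (K : Type) [Field K] [NumberField K]

/-- The finite places belonging to a set `S` of places of `K`. -/
def finPart (S : Finset (NFPlace K)) : Set (HeightOneSpectrum (𝓞 K)) :=
  {v | Sum.inr v ∈ S}

/-- The ring of `S`-integers of `K` (as a subalgebra of `K`): the elements of `K` whose
valuation is at most one at every finite place outside `S`. -/
def SIntegers (S : Finset (NFPlace K)) : Subalgebra (𝓞 K) K :=
  (finPart K S).integer K

/-- A place `v` of `K` splits in an extension `L` of `K` if it has (at least) two distinct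
extensions to `L`: for an infinite place, two distinct infinite places of `L` lying above
it; for a finite place, two distinct nonzero prime ideals of `𝓞 L` lying above it. -/
def SplitsIn (L : Type) [Field L] [Algebra K L] : NFPlace K → Prop
  | Sum.inl v => ∃ w₁ w₂ : NumberField.InfinitePlace L, w₁ ≠ w₂ ∧
      w₁.comap (algebraMap K L) = v ∧ w₂.comap (algebraMap K L) = v
  | Sum.inr v => ∃ P Q : Ideal (𝓞 L), P ≠ Q ∧ P.IsPrime ∧ Q.IsPrime ∧ P ≠ ⊥ ∧ Q ≠ ⊥ ∧
      P.comap (algebraMap (𝓞 K) (𝓞 L)) = v.asIdeal ∧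
      Q.comap (algebraMap (𝓞 K) (𝓞 L)) = v.asIdeal

/-- A (geometrically integral) affine algebraic curve in `𝔸ⁿ` defined over `K`, given by
an ideal of polynomials over `K` whose extension to the algebraic closure of `K` is prime
and cuts out a one-dimensional variety. -/
structure AffineCurve (n : ℕ) : Type where
  /-- The ideal of polynomials over `K` vanishing on the curve. -/
  J : Ideal (MvPolynomial (Fin n) K)
  /-- Geometric integrality: the extension of `J` to the algebraic closure is prime. -/
  hprime : (J.map (MvPolynomial.map (algebraMap K (AlgebraicClosure K)))).IsPrime
  /-- The curve is one-dimensional. -/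
  hdim : ringKrullDim (MvPolynomial (Fin n) (AlgebraicClosure K) ⧸
      J.map (MvPolynomial.map (algebraMap K (AlgebraicClosure K)))) = 1

namespace AffineCurve

variable {K} {n : ℕ} (C : AffineCurve K n)

/-- The ideal of the curve over the algebraic closure. -/
def idealBar : Ideal (MvPolynomial (Fin n) (AlgebraicClosure K)) :=
  C.J.map (MvPolynomial.map (algebraMap K (AlgebraicClosure K)))

instance : C.idealBar.IsPrime := C.hprime

/-- The coordinate ring of the curve over the algebraic closure. -/
abbrev CoordRing := MvPolynomial (Fin n) (AlgebraicClosure K) ⧸ C.idealBar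

/-- The function field `K̄(C)` of the curve over the algebraic closure of `K`. -/
abbrev FunField := FractionRing C.CoordRing

/-- The coordinate functions `x₁, …, xₙ`, as elements of the function field. -/
def xcoord (i : Fin n) : C.FunField :=
  algebraMap C.CoordRing C.FunField (Ideal.Quotient.mk C.idealBar (MvPolynomial.X i))

/-- The embedding of the constants `K̄` into the function field. -/
def constMap : AlgebraicClosure K →+* C.FunField :=
  ((algebraMap C.CoordRing C.FunField) : C.CoordRing →+* C.FunField).comp
    ((Ideal.Quotient.mk C.idealBar).comp MvPolynomial.C)

/-- The embedding of `K` into the function field. -/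
def constMapK : K →+* C.FunField := C.constMap.comp (algebraMap K (AlgebraicClosure K))

/-- A place of the curve: a nontrivial valuation subring of `K̄(C)` containing the
constants `K̄`. -/
def IsPlace (V : ValuationSubring C.FunField) : Prop :=
  (∀ a : AlgebraicClosure K, C.constMap a ∈ V) ∧ V ≠ ⊤

/-- A point at infinity of the curve: a place of `K̄(C)` at which at least one of the
coordinate functions admits a pole. -/
def IsPointAtInfinity (V : ValuationSubring C.FunField) : Prop :=
  C.IsPlace V ∧ ∃ i, C.xcoord i ∉ V

/-- The curve has genus `0`: equivalently (the field of constants `K̄` being algebraically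
closed), its function field is a rational function field `K̄(t)`. -/
def GenusZero : Prop :=
  ∃ t : C.FunField, Subfield.closure (Set.range C.constMap ∪ {t}) = ⊤

/-- `σ` is an automorphism of `K̄(C)` over `K(C) = K(x₁, …, xₙ)`. -/
def FixesKC (σ : C.FunField ≃+* C.FunField) : Prop :=
  (∀ a : K, σ (C.constMapK a) = C.constMapK a) ∧ ∀ i, σ (C.xcoord i) = C.xcoord i

/-- A place of `K̄(C)` is defined over `K` if it is fixed by every automorphism of
`K̄(C)` over `K(C)`. -/
def DefinedOverK (V : ValuationSubring C.FunField) : Prop :=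
  ∀ σ : C.FunField ≃+* C.FunField, C.FixesKC σ → V.comap σ.toRingHom = V

/-- Two places of `K̄(C)` are conjugate over `K` if some automorphism of `K̄(C)` over
`K(C)` interchanges them. -/
def ConjugateOverK (A B : ValuationSubring C.FunField) : Prop :=
  ∃ σ : C.FunField ≃+* C.FunField, C.FixesKC σ ∧
    A.comap σ.toRingHom = B ∧ B.comap σ.toRingHom = A

/-- `σ` is an automorphism of `K̄(C)` over `L(C)`, for an intermediate field
`K ⊆ L ⊆ K̄`. -/
def FixesLC (L : IntermediateField K (AlgebraicClosure K)) (σ : C.FunField ≃+* C.FunField) :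
    Prop :=
  (∀ a : L, σ (C.constMap a) = C.constMap a) ∧ ∀ i, σ (C.xcoord i) = C.xcoord i

/-- A place of `K̄(C)` is defined over `L` if it is fixed by every automorphism of
`K̄(C)` over `L(C)`. -/
def DefinedOver (L : IntermediateField K (AlgebraicClosure K))
    (V : ValuationSubring C.FunField) : Prop :=
  ∀ σ : C.FunField ≃+* C.FunField, C.FixesLC L σ → V.comap σ.toRingHom = V

/-- `P` is a `K`-rational point of the curve. -/
def OnCurve (P : Fin n → K) : Prop := ∀ f ∈ C.J, MvPolynomial.eval P f = 0

/-- The set `C(O_S)` of `S`-integral points of the curve: the `K`-rational points all of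
whose coordinates are `S`-integers. -/
def SIntegralPoints (S : Finset (NFPlace K)) : Set (Fin n → K) :=
  {P | C.OnCurve P ∧ ∀ i, P i ∈ SIntegers K S}

/-- `P` is a non-singular point of the curve: `P` lies on the curve and the gradients at
`P` of the polynomials vanishing on the curve span a space of dimension `n - 1`
(Jacobian criterion for a one-dimensional variety). -/
def IsNonsingularPoint (P : Fin n → K) : Prop :=
  C.OnCurve P ∧ Module.finrank K (Submodule.span K
    {g : Fin n → K | ∃ f ∈ C.J, g = fun i => MvPolynomial.eval P (MvPolynomial.pderiv i f)}) =
      n - 1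

end AffineCurve

/-- An automorphism of a number field preserving a prime ideal preserves the associated
valuation. -/
lemma valuation_algEquiv_of_comap_eq {L : Type*} [Field L] [NumberField L] (τ : L ≃+* L)
    (w : HeightOneSpectrum (𝓞 L))
    (h : w.asIdeal.comap (RingOfIntegers.mapRingEquiv τ) = w.asIdeal) (x : L) :
    w.valuation L (τ x) = w.valuation L x := by
  have hpow (k : ℕ) : (w.asIdeal ^ k).comap (RingOfIntegers.mapRingEquiv τ) = w.asIdeal ^ k := by
    rw [← Ideal.map_symm, Ideal.map_pow, Ideal.map_symm, h]
  have hint (r : 𝓞 L) :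
      w.intValuation (RingOfIntegers.mapRingEquiv τ r) = w.intValuation r := by
    have key (k : ℕ) : w.intValuation (RingOfIntegers.mapRingEquiv τ r) ≤ WithZero.exp (-(k : ℤ)) ↔
        w.intValuation r ≤ WithZero.exp (-(k : ℤ)) := by
      rw [w.intValuation_le_pow_iff_mem, w.intValuation_le_pow_iff_mem]
      conv_rhs => rw [← hpow k, Ideal.mem_comap]
    by_cases hr : r = 0
    · simp [hr]
    have hr' : RingOfIntegers.mapRingEquiv τ r ≠ 0 := by simpa using hr
    refine le_antisymm ?_ ?_
    · rw [w.intValuation_eq_exp_neg_multiplicity hr, key,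
        w.intValuation_eq_exp_neg_multiplicity hr]
    · rw [w.intValuation_eq_exp_neg_multiplicity hr', ← key,
        w.intValuation_eq_exp_neg_multiplicity hr']
  obtain ⟨a, b, -, rfl⟩ := IsFractionRing.div_surjective (A := 𝓞 L) x
  have hτ (r : 𝓞 L) : τ (algebraMap (𝓞 L) L r) =
      algebraMap (𝓞 L) L (RingOfIntegers.mapRingEquiv τ r) := rfl
  simp only [map_div₀, hτ, HeightOneSpectrum.valuation_of_algebraMap, hint]

/-- Over an infinite place that does not split there is a Galois invariant absolute value. -/
lemma exists_invariant_absoluteValue_infinite {K L : Type} [Field K] [NumberField K] [Field L]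
    [NumberField L] [Algebra K L] (τ : L ≃ₐ[K] L) (v : InfinitePlace K)
    (hv : ¬ SplitsIn K L (Sum.inl v)) :
    ∃ w : AbsoluteValue L ℝ, (∀ x, w (τ x) = w x) ∧ ∀ x : K, w (algebraMap K L x) = v x := by
  have : Algebra.IsAlgebraic K L := Algebra.IsAlgebraic.tower_top (K := ℚ) K
  obtain ⟨w, hw⟩ := InfinitePlace.comap_surjective (k := K) (K := L) v
  have hw' : w.comap (τ : L →+* L) = w := by
    by_contra hne
    refine hv ⟨_, w, hne, ?_, hw⟩
    rw [← InfinitePlace.comap_comp]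
    convert hw using 2
    ext x
    simp
  refine ⟨w.1, fun x => ?_, fun x => ?_⟩
  · exact congrArg (fun u : InfinitePlace L => u x) hw'
  · exact congrArg (fun u : InfinitePlace K => u x) hw

/-- Over a finite place that does not split there is a Galois invariant absolute value, and
a bound for this absolute value gives a common denominator. -/
lemma exists_invariant_absoluteValue_finite {K L : Type} [Field K] [NumberField K] [Field L]
    [NumberField L] [Algebra K L] (τ : L ≃ₐ[K] L) (v : HeightOneSpectrum (𝓞 K))
    (hv : ¬ SplitsIn K L (Sum.inr v)) :
    ∃ w : AbsoluteValue L ℝ, (∀ x, w (τ x) = w x) ∧ ∀ M : ℝ, ∃ N : ℕ, N ≠ 0 ∧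
      ∀ x : K, w (algebraMap K L x) ≤ M → v.valuation K (N * x) ≤ 1 := by
  obtain ⟨Q, hQp, hQ⟩ := Ideal.exists_maximal_ideal_liesOver_of_isIntegral (S := 𝓞 L) v.asIdeal
  have hQbot : Q ≠ ⊥ := Ideal.ne_bot_of_liesOver_of_ne_bot v.ne_bot Q
  let w : HeightOneSpectrum (𝓞 L) := ⟨Q, hQp.isPrime, hQbot⟩
  have hover : Q.comap (algebraMap (𝓞 K) (𝓞 L)) = v.asIdeal := hQ.over.symm
  let e := RingOfIntegers.mapRingEquiv (τ : L ≃+* L)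
  have hinv : w.asIdeal.comap e = w.asIdeal := by
    by_contra hne
    refine hv ⟨Q.comap e, Q, hne, hQp.isPrime.comap e, hQp.isPrime, ?_, hQbot, ?_, hover⟩
    · intro hbot
      apply hQbot
      rw [← Ideal.map_symm] at hbot
      exact (Ideal.map_eq_bot_iff_of_injective e.symm.injective).1 hbot
    · rw [← hover]
      change Ideal.comap _ (Ideal.comap (e : 𝓞 L →+* 𝓞 L) Q) = _
      rw [Ideal.comap_comap]
      congr 1
      ext x
      exact τ.commutes (x : K)
  have hb := NumberField.HeightOneSpectrum.one_lt_absNorm_nnreal w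
  refine ⟨w.adicAbv hb, fun x => ?_, fun M => ?_⟩
  · have := valuation_algEquiv_of_comap_eq (τ : L ≃+* L) w hinv x
    change ((w.adicAbvDef hb (τ x) : NNReal) : ℝ) = w.adicAbvDef hb x
    unfold HeightOneSpectrum.adicAbvDef
    rw [← this]
    rfl
  · let p := Ideal.absNorm v.asIdeal
    have hp0 : p ≠ 0 := by simpa [p, Ideal.absNorm_eq_zero_iff] using v.ne_bot
    have hpv : (p : 𝓞 K) ∈ v.asIdeal := Ideal.absNorm_mem _
    have hpw : (p : 𝓞 L) ∈ w.asIdeal := by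
      have : (p : 𝓞 K) ∈ Q.comap (algebraMap (𝓞 K) (𝓞 L)) := hover ▸ hpv
      simpa using this
    have hlt : w.adicAbv hb (p : L) < 1 := by
      simpa using (w.adicAbv_coe_lt_one_iff (K := L) hb _).2 hpw
    obtain ⟨k, hk⟩ := exists_pow_lt_of_lt_one (show (0 : ℝ) < 1 / (|M| + 1) by positivity) hlt
    refine ⟨p ^ k, pow_ne_zero _ hp0, fun x hx => ?_⟩
    have hle : w.adicAbv hb (algebraMap K L ((p ^ k : ℕ) * x)) ≤ 1 := by
      rw [map_mul, map_natCast, map_mul, Nat.cast_pow, map_pow]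
      calc _ ≤ 1 / (|M| + 1) * |M| := by
            gcongr
            exact hx.trans (le_abs_self M)
        _ ≤ 1 := by
            rw [div_mul_eq_mul_div, div_le_one (by positivity)]
            linarith
    have hle' : w.valuation L (algebraMap K L ((p ^ k : ℕ) * x)) ≤ 1 := by
      have h1 : (w.adicAbvDef hb (algebraMap K L ((p ^ k : ℕ) * x)) : NNReal) ≤ 1 := by
        exact_mod_cast hle
      unfold HeightOneSpectrum.adicAbvDef at h1
      rw [← map_one (WithZeroMulInt.toNNReal (ne_zero_of_lt hb))] at h1
      exact (WithZeroMulInt.toNNReal_strictMono hb).le_iff_le.1 h1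
    have : w.asIdeal.LiesOver v.asIdeal := hQ
    rw [← HeightOneSpectrum.valuation_liesOver L v w] at hle'
    exact (pow_le_one_iff (Ideal.IsDedekindDomain.ramificationIdx'_ne_zero_of_liesOver
      w.asIdeal v.ne_bot)).1 hle'

/-- Bounds at the places of `S` imply finiteness of a set of `S`-integral points. -/
lemma finite_of_bounded_at_places {K : Type} [Field K] [NumberField K] {n : ℕ}
    (S : Finset (NFPlace K)) (X : Set (Fin n → K)) (hX : ∀ P ∈ X, ∀ i, P i ∈ SIntegers K S)
    (hinf : ∀ v : InfinitePlace K, ∃ M : ℝ, ∀ P ∈ X, ∀ i, v (P i) ≤ M)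
    (hfin : ∀ v : HeightOneSpectrum (𝓞 K), Sum.inr v ∈ S → ∃ N : ℕ, N ≠ 0 ∧
      ∀ P ∈ X, ∀ i, v.valuation K (N * P i) ≤ 1) : X.Finite := by
  classical
  have hfin' : ∀ v : NFPlace K, ∃ N : ℕ, N ≠ 0 ∧ ∀ u, v = Sum.inr u → Sum.inr u ∈ S →
      ∀ P ∈ X, ∀ i, u.valuation K (N * P i) ≤ 1 := by
    rintro (v | v)
    · exact ⟨1, one_ne_zero, by simp⟩
    · by_cases hv : Sum.inr v ∈ S
      · obtain ⟨N, hN, h⟩ := hfin v hv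
        refine ⟨N, hN, fun u hu _ => ?_⟩
        obtain rfl := Sum.inr_injective hu
        exact h
      · refine ⟨1, one_ne_zero, fun u hu hu' => ?_⟩
        obtain rfl := Sum.inr_injective hu
        exact absurd hu' hv
  choose N hN0 hN using hfin'
  choose M hM using hinf
  let D := ∏ v ∈ S, N v
  have hD : (D : K) ≠ 0 := by exact_mod_cast Finset.prod_ne_zero_iff.2 fun v _ => hN0 v
  have hnat (v : HeightOneSpectrum (𝓞 K)) (m : ℕ) : v.valuation K (m : K) ≤ 1 := by
    simpa using v.valuation_le_one (K := K) (m : 𝓞 K)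
  have hint : ∀ P ∈ X, ∀ i, IsIntegral ℤ ((D : K) * P i) := by
    intro P hP i
    have : (D : K) * P i ∈ (algebraMap (𝓞 K) K).range := by
      refine HeightOneSpectrum.mem_integers_of_valuation_le_one K _ fun v => ?_
      by_cases hv : Sum.inr v ∈ S
      · have hsplit : (D : K) * P i =
            ((∏ u ∈ S.erase (Sum.inr v), N u : ℕ) : K) * (N (Sum.inr v) * P i) := by
          rw [← mul_assoc, ← Nat.cast_mul, Finset.prod_erase_mul S N hv]
        rw [hsplit, map_mul]
        exact mul_le_one' (hnat v _) (hN _ v rfl hv P hP i)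
      · rw [map_mul]
        exact mul_le_one' (hnat v _) (hX P hP i v hv)
    obtain ⟨r, hr⟩ := this
    rw [← hr]
    exact RingOfIntegers.isIntegral_coe r
  let T : ℝ := ∑ v, |(D : ℝ) * M v|
  have hfinite := Embeddings.finite_of_norm_le K ℂ T
  refine ((Set.Finite.pi' fun _ : Fin n => hfinite).preimage
    (f := fun P i => (D : K) * P i) ?_).subset ?_
  · intro P _ Q _ h
    funext i
    exact mul_left_cancel₀ hD (congrFun h i)
  · intro P hP i
    refine ⟨hint P hP i, fun φ => ?_⟩
    rw [← InfinitePlace.apply φ, map_mul]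
    have h1 : InfinitePlace.mk φ (D : K) = D := by simp
    rw [h1]
    calc (D : ℝ) * InfinitePlace.mk φ (P i) ≤ D * M (InfinitePlace.mk φ) := by
          gcongr
          exact hM _ P hP i
      _ ≤ |(D : ℝ) * M (InfinitePlace.mk φ)| := le_abs_self _
      _ ≤ T := Finset.single_le_sum (f := fun v => |(D : ℝ) * M v|)
          (fun _ _ => abs_nonneg _) (Finset.mem_univ _)

/-- A quadratic extension in characteristic zero is generated by a square root, whose sign is
changed by the non-trivial automorphism. -/
lemma exists_sqrt_generator (K L : Type*) [Field K] [CharZero K] [Field L] [Algebra K L]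
    (h : Module.finrank K L = 2) :
    ∃ (θ : L) (d : K) (τ : L ≃ₐ[K] L), θ ^ 2 = algebraMap K L d ∧ τ θ = -θ ∧
      ∀ l : L, ∃ a b : K, l = algebraMap K L a + algebraMap K L b * θ := by
  have : Algebra.IsQuadraticExtension K L := ⟨h⟩
  have : CharZero L := charZero_of_injective_algebraMap (algebraMap K L).injective
  have hcard : Nat.card (L ≃ₐ[K] L) = 2 := by rw [IsGalois.card_aut_eq_finrank, h]
  obtain ⟨τ, hτ, huniq⟩ := (Nat.card_eq_two_iff' (1 : L ≃ₐ[K] L)).1 hcard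
  have hττ (x : L) : τ (τ x) = x := by
    have : τ ^ 2 = 1 := hcard ▸ pow_card_eq_one'
    rw [pow_two] at this
    exact DFunLike.congr_fun this x
  have hfix (x : L) (hx : τ x = x) : ∃ a : K, algebraMap K L a = x := by
    refine (IsGalois.mem_range_algebraMap_iff_fixed x).2 fun f => ?_
    by_cases hf : f = 1
    · simp [hf]
    · rw [huniq f hf, hx]
  obtain ⟨l, hl⟩ : ∃ l, τ l ≠ l := by
    by_contra! hcon
    exact hτ (AlgEquiv.ext hcon)
  have hθ : l - τ l ≠ 0 := sub_ne_zero.2 hl.symm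
  obtain ⟨d, hd⟩ := hfix ((l - τ l) ^ 2) (by simp only [map_pow, map_sub, hττ]; ring)
  refine ⟨l - τ l, d, τ, hd.symm, by simp [hττ], fun x => ?_⟩
  obtain ⟨a, ha⟩ := hfix ((x + τ x) / 2) (by simp [hττ, map_ofNat, add_comm])
  obtain ⟨b, hb⟩ := hfix ((x - τ x) / (2 * (l - τ l))) (by
    simp only [map_div₀, map_sub, map_mul, hττ, map_ofNat]
    rw [← neg_sub x, ← neg_sub l, mul_neg, neg_div_neg_eq])
  refine ⟨a, b, ?_⟩
  rw [ha, hb]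
  field_simp
  ring

/-- Elements lying in the maximal ideal of every valuation ring (over `K`) at which `y⁻¹` has a
pole satisfy an equation `y⁻¹ ∈ K[y, g⁻¹]`. -/
lemma inv_mem_adjoin_of_forall_mem_nonunits {K F : Type*} [Field K] [Field F] [Algebra K F]
    {y g : F} (hy : y ≠ 0) (hg : g ≠ 0)
    (h : ∀ V : ValuationSubring F, (∀ a : K, algebraMap K F a ∈ V) → y⁻¹ ∉ V →
      g ∈ V.nonunits) : y⁻¹ ∈ Algebra.adjoin K {y, g⁻¹} := by
  let R := Algebra.adjoin K {y, g⁻¹}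
  have hyR : y ∈ R := Algebra.subset_adjoin (by simp)
  have hgR : g⁻¹ ∈ R := Algebra.subset_adjoin (by simp)
  by_contra hcon
  let I : Ideal R.toSubring := Ideal.span {⟨y, hyR⟩}
  have hI : I ≠ ⊤ := by
    rw [Ne, Ideal.span_singleton_eq_top]
    rintro hu
    obtain ⟨z, hz⟩ := hu.exists_right_inv
    have hz' : y * (z : F) = 1 := congrArg Subtype.val hz
    exact hcon (by rw [inv_eq_of_mul_eq_one_right hz']; exact z.2)
  obtain ⟨V, hRV, hIV⟩ := Ideal.image_subset_nonunits_valuationSubring I hI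
  have hyV : y ∈ V.nonunits := hIV ⟨⟨y, hyR⟩, Ideal.mem_span_singleton_self _, rfl⟩
  have hgV := h V (fun a => hRV (R.algebraMap_mem a))
    ((V.mem_nonunits_iff_or.1 hyV).resolve_left hy)
  exact (V.mem_nonunits_iff_or.1 hgV).resolve_left hg (hRV hgR)

/-- A valuation ring containing a field contains all elements algebraic over it. -/
lemma ValuationSubring.mem_of_isIntegral {K F : Type*} [Field K] [Field F] [Algebra K F]
    (V : ValuationSubring F) (hV : ∀ c : K, algebraMap K F c ∈ V) {x : F} (hx : IsIntegral K x) :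
    x ∈ V := by
  obtain ⟨p, hp, hpx⟩ := hx
  have hxV : IsIntegral V x := by
    refine ⟨p.map ((algebraMap K F).codRestrict V hV), hp.map _, ?_⟩
    rw [Polynomial.eval₂_map]
    exact hpx
  obtain ⟨z, rfl⟩ := IsIntegrallyClosed.isIntegral_iff.1 hxV
  exact z.2

lemma ValuationSubring.mem_nonunits_comap_iff {F : Type*} [Field F] (V : ValuationSubring F)
    (σ : F ≃+* F) (x : F) : x ∈ (V.comap σ.toRingHom).nonunits ↔ σ x ∈ V.nonunits := by
  simp [ValuationSubring.mem_nonunits_iff_or, ValuationSubring.mem_comap]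

/-- Incomparable valuation rings are separated by an element. -/
lemma ValuationSubring.exists_separating {F : Type*} [Field F] {A B : ValuationSubring F}
    (hAB : ¬ A ≤ B) (hBA : ¬ B ≤ A) : ∃ f, f ∈ A.nonunits ∧ f - 1 ∈ B.nonunits := by
  obtain ⟨a, haA, haB⟩ := Set.not_subset.1 hAB
  obtain ⟨b, hbB, hbA⟩ := Set.not_subset.1 hBA
  have hlt {V : ValuationSubring F} {x z : F} (hx : x ∈ V) (hz : z ∉ V) :
      V.valuation (x / (x + z)) < 1 := by
    have hxz : V.valuation x < V.valuation z :=
      lt_of_le_of_lt ((V.valuation_le_one_iff x).2 hx)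
        (not_le.1 fun hle => hz ((V.valuation_le_one_iff z).1 hle))
    rw [map_div₀, Valuation.map_add_eq_of_lt_right _ hxz]
    exact (div_lt_one₀ (lt_of_le_of_lt zero_le hxz)).2 hxz
  refine ⟨a / (a + b), hlt haA hbA, ?_⟩
  have hab : a + b ≠ 0 := fun h0 => haB (by
    rw [eq_neg_of_add_eq_zero_left h0]
    exact B.neg_mem _ hbB)
  have : a / (a + b) - 1 = -(b / (b + a)) := by
    rw [add_comm b a]
    field_simp
    ring
  rw [this, ValuationSubring.mem_nonunits_iff, Valuation.map_neg]
  exact hlt hbB haB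

lemma ValuationSubring.multiset_prod_mem_nonunits {F : Type*} [Field F] (V : ValuationSubring F)
    (s : Multiset F) (hs : s ≠ 0) (h : ∀ r ∈ s, r ∈ V.nonunits) : s.prod ∈ V.nonunits := by
  induction s using Multiset.induction_on with
  | empty => exact absurd rfl hs
  | cons r s ih =>
    rw [Multiset.prod_cons]
    by_cases hs0 : s = 0
    · simpa [hs0] using h r (by simp)
    · exact MulMemClass.mul_mem (h r (by simp)) (ih hs0 fun t ht => h t (by simp [ht]))

lemma ValuationSubring.multiset_prod_sub_one_mem_nonunits {F : Type*} [Field F]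
    (V : ValuationSubring F) (s : Multiset F) (h : ∀ r ∈ s, r - 1 ∈ V.nonunits) :
    s.prod - 1 ∈ V.nonunits := by
  induction s using Multiset.induction_on with
  | empty => simp
  | cons r s ih =>
    have hr := h r (by simp)
    have hs := ih fun t ht => h t (by simp [ht])
    rw [Multiset.prod_cons]
    have : r * s.prod - 1 = (r - 1) * (s.prod - 1) + ((r - 1) + (s.prod - 1)) := by ring
    rw [this]
    rw [ValuationSubring.mem_nonunits_iff] at *
    refine Valuation.map_add_lt _ ?_ (Valuation.map_add_lt _ hr hs)
    rw [map_mul]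
    exact mul_lt_one' hr hs

/-- A field generated over `E` by algebraically closed constants, algebraic over a subfield
`K` of `E`, is normal over `E`. -/
lemma normal_of_adjoin_range_eq_top {K Ω E F : Type*} [Field K] [Field Ω] [Field E] [Field F]
    [Algebra K Ω] [Algebra Ω F] [Algebra K F] [Algebra K E] [Algebra E F] [IsScalarTower K Ω F]
    [IsScalarTower K E F] [IsAlgClosed Ω] [Algebra.IsAlgebraic K Ω]
    (h : IntermediateField.adjoin E (Set.range (algebraMap Ω F)) = ⊤) : Normal E F := by
  have hsplit : ∀ x ∈ Set.range (algebraMap Ω F), IsIntegral E x ∧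
      ((minpoly E x).map (algebraMap E F)).Splits := by
    rintro _ ⟨c, rfl⟩
    have hc : IsIntegral K c := Algebra.IsIntegral.isIntegral c
    have hcF : IsIntegral K (algebraMap Ω F c) := hc.map (IsScalarTower.toAlgHom K Ω F)
    refine ⟨hcF.tower_top, ?_⟩
    have hdvd : minpoly E (algebraMap Ω F c) ∣ (minpoly K c).map (algebraMap K E) :=
      minpoly.dvd _ _ (by simp [Polynomial.aeval_map_algebraMap, Polynomial.aeval_algebraMap_apply])
    have hs : ((minpoly K c).map (algebraMap K F)).Splits := by
      rw [IsScalarTower.algebraMap_eq K Ω F, ← Polynomial.map_map]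
      exact (IsAlgClosed.splits _).map _
    refine hs.of_dvd (Polynomial.map_ne_zero (minpoly.ne_zero hc)) ?_
    rw [IsScalarTower.algebraMap_eq K E F, ← Polynomial.map_map]
    exact Polynomial.map_dvd _ hdvd
  have halg : Algebra.IsAlgebraic E F := by
    have := IntermediateField.isAlgebraic_adjoin fun x hx => (hsplit x hx).1
    rw [h] at this
    exact (IntermediateField.topEquiv (F := E) (E := F)).isAlgebraic
  exact { toIsAlgebraic := halg
          splits' := fun x =>
            IntermediateField.splits_of_mem_adjoin E F hsplit (h ▸ IntermediateField.mem_top) }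

/-- If valuation rings `A` and `B` are stable under all automorphisms over `E`, an element
separating them can be chosen in `E`. -/
lemma exists_separating_of_normal {E F : Type*} [Field E] [Field F] [Algebra E F] [Normal E F]
    {A B : ValuationSubring F} (hAB : ¬ A ≤ B) (hBA : ¬ B ≤ A)
    (hA : ∀ σ : F ≃ₐ[E] F, A.comap (σ : F ≃+* F).toRingHom = A)
    (hB : ∀ σ : F ≃ₐ[E] F, B.comap (σ : F ≃+* F).toRingHom = B) :
    ∃ u : E, algebraMap E F u ∈ A.nonunits ∧ algebraMap E F u - 1 ∈ B.nonunits := by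
  obtain ⟨f, hfA, hfB⟩ := ValuationSubring.exists_separating hAB hBA
  let p := minpoly E f
  have hint : IsIntegral E f := Normal.isIntegral inferInstance f
  have hsplit : (p.map (algebraMap E F)).Splits := Normal.splits inferInstance f
  have hmonic : (p.map (algebraMap E F)).Monic := (minpoly.monic hint).map _
  have hroot : ∀ r ∈ (p.map (algebraMap E F)).roots, ∃ σ : F ≃ₐ[E] F, σ f = r := by
    intro r hr
    refine minpoly.exists_algEquiv_of_root' hint.isAlgebraic ?_
    rw [Polynomial.mem_roots hmonic.ne_zero, Polynomial.IsRoot, Polynomial.eval_map_algebraMap] at hr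
    exact hr
  have hne : (p.map (algebraMap E F)).roots ≠ 0 := by
    intro h0
    have : f ∈ (p.map (algebraMap E F)).roots := by
      rw [Polynomial.mem_roots hmonic.ne_zero, Polynomial.IsRoot, Polynomial.eval_map_algebraMap]
      exact minpoly.aeval E f
    simp [h0] at this
  refine ⟨(-1) ^ p.natDegree * p.coeff 0, ?_⟩
  have hprod : algebraMap E F ((-1) ^ p.natDegree * p.coeff 0) =
      (p.map (algebraMap E F)).roots.prod := by
    have := hsplit.coeff_zero_eq_prod_roots_of_monic hmonic
    rw [Polynomial.coeff_map, Polynomial.natDegree_map] at this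
    rw [map_mul, this, map_pow, map_neg, map_one, ← mul_assoc, ← mul_pow]
    simp
  rw [hprod]
  refine ⟨A.multiset_prod_mem_nonunits _ hne fun r hr => ?_,
    B.multiset_prod_sub_one_mem_nonunits _ fun r hr => ?_⟩
  · obtain ⟨σ, rfl⟩ := hroot r hr
    rw [← hA σ, ValuationSubring.mem_nonunits_comap_iff] at hfA
    exact hfA
  · obtain ⟨σ, rfl⟩ := hroot r hr
    rw [← hB σ, ValuationSubring.mem_nonunits_comap_iff, map_sub, map_one] at hfB
    exact hfB

lemma mem_adjoin_sqrt {E F : Type*} [Field E] [Field F] [Algebra E F] {θ : F} {d : E}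
    (hθ : θ ^ 2 = algebraMap E F d) {u : F} (hu : u ∈ IntermediateField.adjoin E {θ}) :
    ∃ a b : E, u = algebraMap E F a + algebraMap E F b * θ := by
  have hint : IsIntegral E θ := IsIntegral.of_pow two_pos (hθ ▸ isIntegral_algebraMap)
  rw [← IntermediateField.mem_toSubalgebra,
    IntermediateField.adjoin_simple_toSubalgebra_of_isAlgebraic hint.isAlgebraic] at hu
  induction hu using Algebra.adjoin_induction with
  | mem x hx =>
    obtain rfl := Set.mem_singleton_iff.1 hx
    exact ⟨0, 1, by simp⟩
  | algebraMap r => exact ⟨r, 0, by simp⟩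
  | add x y _ _ hx hy =>
    obtain ⟨a, b, rfl⟩ := hx
    obtain ⟨a', b', rfl⟩ := hy
    exact ⟨a + a', b + b', by simp only [map_add]; ring⟩
  | mul x y _ _ hx hy =>
    obtain ⟨a, b, rfl⟩ := hx
    obtain ⟨a', b', rfl⟩ := hy
    refine ⟨a * a' + b * b' * d, a * b' + a' * b, ?_⟩
    simp only [map_add, map_mul, ← hθ]
    ring

/-- Given two valuation rings interchanged by an automorphism over `E` and stable under the
automorphisms over `E(√d)`, there is an element `a + b√d` whose norm and whose trace minus one
lie in both maximal ideals. -/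
lemma exists_norm_trace_mem_nonunits {E F : Type*} [Field E] [Field F] [Algebra E F] [Normal E F]
    {A B : ValuationSubring F} (hAB : A ≠ B) {θ : F} {d : E} (hθ : θ ^ 2 = algebraMap E F d)
    (hA : ∀ σ : F ≃ₐ[E] F, σ θ = θ → A.comap (σ : F ≃+* F).toRingHom = A)
    (hB : ∀ σ : F ≃ₐ[E] F, σ θ = θ → B.comap (σ : F ≃+* F).toRingHom = B)
    (σ : F ≃ₐ[E] F) (hσA : A.comap (σ : F ≃+* F).toRingHom = B)
    (hσB : B.comap (σ : F ≃+* F).toRingHom = A) :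
    ∃ a b : E,
      (algebraMap E F (a ^ 2 - d * b ^ 2) ∈ A.nonunits ∧
        algebraMap E F (a ^ 2 - d * b ^ 2) ∈ B.nonunits) ∧
      (algebraMap E F (2 * a - 1) ∈ A.nonunits ∧ algebraMap E F (2 * a - 1) ∈ B.nonunits) := by
  have hle_iff : A ≤ B ↔ B ≤ A := by
    constructor
    · intro h x hx
      rw [← hσA] at hx
      rw [← hσB]
      exact h hx
    · intro h x hx
      rw [← hσB] at hx
      rw [← hσA]
      exact h hx
  have hAB' : ¬ A ≤ B := fun h => hAB (le_antisymm h (hle_iff.1 h))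
  have hBA' : ¬ B ≤ A := fun h => hAB' (hle_iff.2 h)
  let M := IntermediateField.adjoin E {θ}
  have hθM : θ ∈ M := IntermediateField.mem_adjoin_simple_self E θ
  have hfixθ (ρ : F ≃ₐ[M] F) : ρ.restrictScalars E θ = θ := ρ.commutes ⟨θ, hθM⟩
  obtain ⟨u, huA, huB⟩ := exists_separating_of_normal (E := M) hAB' hBA'
    (fun ρ => hA (ρ.restrictScalars E) (hfixθ ρ)) (fun ρ => hB (ρ.restrictScalars E) (hfixθ ρ))
  obtain ⟨a, b, hab⟩ := mem_adjoin_sqrt hθ u.2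
  change (u : F) ∈ A.nonunits at huA
  change (u : F) - 1 ∈ B.nonunits at huB
  have hσθ : σ θ = -θ := by
    refine (sq_eq_sq_iff_eq_or_eq_neg.1 ?_).resolve_left fun h => hAB ?_
    · rw [← map_pow, hθ, σ.commutes]
    · rw [← hA σ h, hσA]
  have hσu : σ u = algebraMap E F a - algebraMap E F b * θ := by
    rw [hab]
    simp [hσθ, sub_eq_add_neg]
  have hσuB : σ u ∈ B.nonunits := by
    rw [← hσB, ValuationSubring.mem_nonunits_comap_iff] at huA
    exact huA
  have hσuA : σ u - 1 ∈ A.nonunits := by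
    rw [← hσA, ValuationSubring.mem_nonunits_comap_iff, map_sub, map_one] at huB
    exact huB
  have hnorm : algebraMap E F (a ^ 2 - d * b ^ 2) = u * σ u := by
    rw [hσu, hab]
    simp only [map_sub, map_mul, map_pow, ← hθ]
    ring
  have htrace : algebraMap E F (2 * a - 1) = u + (σ u - 1) := by
    rw [hσu, hab]
    simp only [map_sub, map_mul, map_ofNat, map_one]
    ring
  have htrace' : algebraMap E F (2 * a - 1) = σ u + (u - 1) := by
    rw [htrace]
    ring
  have hadd {V : ValuationSubring F} {x z : F} (hx : x ∈ V.nonunits) (hz : z ∈ V.nonunits) :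
      x + z ∈ V.nonunits := by
    rw [ValuationSubring.mem_nonunits_iff] at *
    exact Valuation.map_add_lt _ hx hz
  have hunit {V : ValuationSubring F} {x z : F} (hx : x ∈ V.nonunits) (hz : z - 1 ∈ V.nonunits) :
      x * z ∈ V.nonunits := by
    have : x * z = x * (z - 1) + x := by ring
    rw [this]
    exact hadd (mul_mem hx hz) hx
  refine ⟨a, b, ⟨?_, ?_⟩, ?_, ?_⟩
  · rw [hnorm]
    exact hunit huA hσuA
  · rw [hnorm, mul_comm]
    exact hunit hσuB huB
  · rw [htrace]
    exact hadd huA hσuA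
  · rw [htrace']
    exact hadd hσuB huB

namespace AffineCurve

variable {K : Type} [Field K] {n : ℕ} (C : AffineCurve K n)

lemma aeval_xcoord (f : MvPolynomial (Fin n) K) :
    MvPolynomial.aeval C.xcoord f = algebraMap C.CoordRing C.FunField
      (Ideal.Quotient.mk C.idealBar (MvPolynomial.map (algebraMap K (AlgebraicClosure K)) f)) := by
  induction f using MvPolynomial.induction_on with
  | C a =>
    rw [MvPolynomial.aeval_C, MvPolynomial.map_C]
    rfl
  | add p q hp hq => simp only [map_add, hp, hq]
  | mul_X p i hp => simp only [map_mul, hp, MvPolynomial.aeval_X, MvPolynomial.map_X, xcoord]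

lemma eval_map_algebraMap (P : Fin n → K) (f : MvPolynomial (Fin n) K) :
    MvPolynomial.eval (fun i => algebraMap K (AlgebraicClosure K) (P i))
      (MvPolynomial.map (algebraMap K (AlgebraicClosure K)) f) =
        algebraMap K (AlgebraicClosure K) (MvPolynomial.eval P f) := by
  rw [MvPolynomial.eval_map, MvPolynomial.eval, MvPolynomial.coe_eval₂Hom,
    MvPolynomial.hom_eval₂]
  rfl

lemma eval_eq_zero_of_mem_idealBar {P : Fin n → K} (hP : C.OnCurve P)
    {f : MvPolynomial (Fin n) (AlgebraicClosure K)} (hf : f ∈ C.idealBar) :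
    MvPolynomial.eval (fun i => algebraMap K (AlgebraicClosure K) (P i)) f = 0 := by
  have hle : C.idealBar ≤ RingHom.ker
      (MvPolynomial.eval (fun i => algebraMap K (AlgebraicClosure K) (P i))) := by
    refine Ideal.map_le_iff_le_comap.2 fun g hg => ?_
    rw [Ideal.mem_comap, RingHom.mem_ker, eval_map_algebraMap, hP g hg, map_zero]
  exact hle hf

lemma eval_eq_zero_of_aeval_xcoord_eq_zero {P : Fin n → K} (hP : C.OnCurve P)
    {f : MvPolynomial (Fin n) K} (hf : MvPolynomial.aeval C.xcoord f = 0) :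
    MvPolynomial.eval P f = 0 := by
  rw [aeval_xcoord, FaithfulSMul.algebraMap_eq_zero_iff, Ideal.Quotient.eq_zero_iff_mem] at hf
  have := C.eval_eq_zero_of_mem_idealBar hP hf
  rwa [eval_map_algebraMap, map_eq_zero] at this

/-- A function not vanishing on the curve has only finitely many `K`-rational zeros. -/
lemma finite_setOf_eval_eq_zero {f : MvPolynomial (Fin n) K}
    (hf : MvPolynomial.aeval C.xcoord f ≠ 0) :
    {P : Fin n → K | C.OnCurve P ∧ MvPolynomial.eval P f = 0}.Finite := by
  rw [aeval_xcoord, Ne, FaithfulSMul.algebraMap_eq_zero_iff] at hf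
  set g := Ideal.Quotient.mk C.idealBar (MvPolynomial.map (algebraMap K (AlgebraicClosure K)) f)
  have hdim : Ring.KrullDimLE 1 C.CoordRing := by
    rw [Ring.krullDimLE_iff]
    exact C.hdim.le
  have hfin := Ideal.finite_minimalPrimes_of_isNoetherianRing C.CoordRing (Ideal.span {g})
  let ev (P : {P : Fin n → K | C.OnCurve P ∧ MvPolynomial.eval P f = 0}) :
      C.CoordRing →+* AlgebraicClosure K :=
    Ideal.Quotient.lift C.idealBar
      (MvPolynomial.eval (fun i => algebraMap K (AlgebraicClosure K) (P.1 i)))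
      fun _ h => C.eval_eq_zero_of_mem_idealBar P.2.1 h
  have hmin (P) : RingHom.ker (ev P) ∈ (Ideal.span {g}).minimalPrimes := by
    have hgP : ev P g = 0 := by
      change MvPolynomial.eval _ _ = 0
      rw [eval_map_algebraMap, P.2.2, map_zero]
    have hprime : (RingHom.ker (ev P)).IsPrime := RingHom.ker_isPrime _
    obtain ⟨q, hq, hqP⟩ := Ideal.exists_minimalPrimes_le (J := RingHom.ker (ev P))
      ((Ideal.span_singleton_le_iff_mem _).2 hgP)
    have hq0 : q ≠ ⊥ := by
      rintro rfl
      exact hf ((Ideal.span_singleton_le_iff_mem _).1 hq.1.2)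
    have hqmax := Ideal.IsPrime.isMaximal_of_ne_bot hq.1.1 hq0
    rwa [← hqmax.eq_of_le hprime.ne_top hqP]
  have := hfin.to_subtype
  refine Set.finite_coe_iff.1 (Finite.of_injective
    (fun P => (⟨RingHom.ker (ev P), hmin P⟩ : (Ideal.span {g}).minimalPrimes)) ?_)
  intro P Q hPQ
  have hker : RingHom.ker (ev P) = RingHom.ker (ev Q) := congrArg Subtype.val hPQ
  ext i
  have hmem : Ideal.Quotient.mk C.idealBar (MvPolynomial.X i -
      MvPolynomial.C (algebraMap K (AlgebraicClosure K) (P.1 i))) ∈ RingHom.ker (ev P) := by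
    simp [ev, RingHom.mem_ker]
  rw [hker, RingHom.mem_ker] at hmem
  simp only [ev, Ideal.Quotient.lift_mk, map_sub, MvPolynomial.eval_X, MvPolynomial.eval_C,
    sub_eq_zero] at hmem
  exact ((algebraMap K (AlgebraicClosure K)).injective hmem).symm

/-- The function `a` is regular at the point `P` in terms of the coordinates, with value `α`. -/
def HasValue (P : Fin n → K) (a : C.FunField) (α : K) : Prop :=
  ∃ N D : MvPolynomial (Fin n) K, MvPolynomial.eval P D ≠ 0 ∧
    a * MvPolynomial.aeval C.xcoord D = MvPolynomial.aeval C.xcoord N ∧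
    α * MvPolynomial.eval P D = MvPolynomial.eval P N

variable {C}

namespace HasValue

variable {P : Fin n → K} {a b : C.FunField} {α β : K}

lemma const (P : Fin n → K) (c : K) : C.HasValue P (algebraMap K C.FunField c) c :=
  ⟨MvPolynomial.C c, 1, by simp, by simp, by simp⟩

lemma xcoord (P : Fin n → K) (i : Fin n) : C.HasValue P (C.xcoord i) (P i) :=
  ⟨MvPolynomial.X i, 1, by simp, by simp, by simp⟩

lemma add (ha : C.HasValue P a α) (hb : C.HasValue P b β) : C.HasValue P (a + b) (α + β) := by
  obtain ⟨N, D, hD, h1, h2⟩ := ha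
  obtain ⟨N', D', hD', h1', h2'⟩ := hb
  refine ⟨N * D' + N' * D, D * D', by simp [hD, hD'], ?_, ?_⟩
  · simp only [map_add, map_mul, ← h1, ← h1']
    ring
  · simp only [map_add, map_mul, ← h2, ← h2']
    ring

lemma mul (ha : C.HasValue P a α) (hb : C.HasValue P b β) : C.HasValue P (a * b) (α * β) := by
  obtain ⟨N, D, hD, h1, h2⟩ := ha
  obtain ⟨N', D', hD', h1', h2'⟩ := hb
  refine ⟨N * N', D * D', by simp [hD, hD'], ?_, ?_⟩
  · simp only [map_mul, ← h1, ← h1']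
    ring
  · simp only [map_mul, ← h2, ← h2']
    ring

lemma inv (hP : C.OnCurve P) (ha : C.HasValue P a α) (hα : α ≠ 0) :
    C.HasValue P a⁻¹ α⁻¹ := by
  obtain ⟨N, D, hD, h1, h2⟩ := ha
  have hN : MvPolynomial.eval P N ≠ 0 := by
    rw [← h2]
    exact mul_ne_zero hα hD
  have ha0 : a ≠ 0 := by
    rintro rfl
    exact hN (C.eval_eq_zero_of_aeval_xcoord_eq_zero hP (by rw [← h1, zero_mul]))
  refine ⟨D, N, hN, ?_, ?_⟩
  · rw [← h1, inv_mul_cancel_left₀ ha0]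
  · rw [← h2, inv_mul_cancel_left₀ hα]

lemma unique (hP : C.OnCurve P) (ha : C.HasValue P a α) (hb : C.HasValue P a β) : α = β := by
  obtain ⟨N, D, hD, h1, h2⟩ := ha
  obtain ⟨N', D', hD', h1', h2'⟩ := hb
  have hzero : MvPolynomial.aeval C.xcoord (N * D' - N' * D) = 0 := by
    simp only [map_sub, map_mul, ← h1, ← h1']
    ring
  have := C.eval_eq_zero_of_aeval_xcoord_eq_zero hP hzero
  simp only [map_sub, map_mul, ← h2, ← h2'] at this
  refine mul_right_cancel₀ (mul_ne_zero hD hD') ?_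
  linear_combination this

end HasValue

variable (C)

/-- An element of `K(C)` has a value at almost all `K`-rational points. -/
lemma finite_setOf_not_hasValue {a : C.FunField}
    (ha : a ∈ IntermediateField.adjoin K (Set.range C.xcoord)) :
    {P : Fin n → K | C.OnCurve P ∧ ¬ ∃ α, C.HasValue P a α}.Finite := by
  obtain ⟨N, D, rfl⟩ := (IntermediateField.mem_adjoin_range_iff K _ _).1 ha
  by_cases hD : MvPolynomial.aeval C.xcoord D = 0
  · refine Set.Finite.subset Set.finite_empty ?_
    rintro P ⟨-, h⟩
    refine h ⟨0, ?_⟩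
    simpa [hD] using HasValue.const (C := C) P 0
  · refine (C.finite_setOf_eval_eq_zero hD).subset ?_
    rintro P ⟨hP, h⟩
    refine ⟨hP, ?_⟩
    by_contra hPD
    exact h ⟨_, N, D, hPD, div_mul_cancel₀ _ hD, div_mul_cancel₀ _ hPD⟩

/-- A function vanishing at all points at infinity is small at points with a large coordinate. -/
lemma exists_bound_of_mem_nonunits (w : AbsoluteValue K ℝ) (i : Fin n) {g : C.FunField}
    (hg : ∀ V : ValuationSubring C.FunField, (∀ c : K, algebraMap K C.FunField c ∈ V) →
      C.xcoord i ∉ V → g ∈ V.nonunits) {ε : ℝ} (hε : 0 < ε) :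
    ∃ M : ℝ, ∀ P, C.OnCurve P → ∀ γ, C.HasValue P g γ → M < w (P i) → w γ < ε := by
  by_cases hg0 : g = 0
  · refine ⟨0, fun P hP γ hγ _ => ?_⟩
    have h0 : C.HasValue P g 0 := by simpa [hg0] using HasValue.const (C := C) P 0
    simpa [hγ.unique hP h0] using hε
  by_cases hx0 : C.xcoord i = 0
  · refine ⟨0, fun P hP γ hγ hlt => ?_⟩
    have h0 : C.HasValue P (C.xcoord i) 0 := by simpa [hx0] using HasValue.const (C := C) P 0
    simp [(HasValue.xcoord P i).unique hP h0] at hlt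
  have hmem : (C.xcoord i)⁻¹⁻¹ ∈ Algebra.adjoin K {(C.xcoord i)⁻¹, g⁻¹} :=
    inv_mem_adjoin_of_forall_mem_nonunits (inv_ne_zero hx0) hg0 fun V hV hxV =>
      hg V hV (by rwa [inv_inv] at hxV)
  have hbdd : ∀ t ∈ Algebra.adjoin K {(C.xcoord i)⁻¹, g⁻¹}, ∃ M : ℝ, ∀ P, C.OnCurve P →
      ∀ γ, C.HasValue P g γ → 1 < w (P i) → ε ≤ w γ → ∃ t', C.HasValue P t t' ∧ w t' ≤ M := by
    intro t ht
    induction ht using Algebra.adjoin_induction with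
    | mem t ht =>
      rcases ht with rfl | ht
      · refine ⟨1, fun P hP γ hγ h1 _ => ⟨(P i)⁻¹, (HasValue.xcoord P i).inv hP ?_, ?_⟩⟩
        · exact w.ne_zero_iff.1 (by linarith)
        · rw [map_inv₀]
          exact inv_le_one_of_one_le₀ h1.le
      · obtain rfl := Set.mem_singleton_iff.1 ht
        refine ⟨ε⁻¹, fun P hP γ hγ _ h2 => ⟨γ⁻¹, hγ.inv hP ?_, ?_⟩⟩
        · exact w.ne_zero_iff.1 (by linarith)
        · rw [map_inv₀]
          exact inv_anti₀ hε h2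
    | algebraMap c => exact ⟨w c, fun P _ _ _ _ _ => ⟨c, HasValue.const P c, le_rfl⟩⟩
    | add s t _ _ hs ht =>
      obtain ⟨M, hM⟩ := hs
      obtain ⟨M', hM'⟩ := ht
      refine ⟨M + M', fun P hP γ hγ h1 h2 => ?_⟩
      obtain ⟨s', hs', hsM⟩ := hM P hP γ hγ h1 h2
      obtain ⟨t', ht', htM⟩ := hM' P hP γ hγ h1 h2
      exact ⟨s' + t', hs'.add ht', (w.add_le s' t').trans (add_le_add hsM htM)⟩
    | mul s t _ _ hs ht =>
      obtain ⟨M, hM⟩ := hs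
      obtain ⟨M', hM'⟩ := ht
      refine ⟨M * M', fun P hP γ hγ h1 h2 => ?_⟩
      obtain ⟨s', hs', hsM⟩ := hM P hP γ hγ h1 h2
      obtain ⟨t', ht', htM⟩ := hM' P hP γ hγ h1 h2
      refine ⟨s' * t', hs'.mul ht', ?_⟩
      rw [map_mul]
      exact mul_le_mul hsM htM (w.nonneg _) ((w.nonneg _).trans hsM)
  obtain ⟨M, hM⟩ := hbdd _ hmem
  refine ⟨max M 1, fun P hP γ hγ hlt => ?_⟩
  by_contra! hcon
  obtain ⟨t, ht, htM⟩ := hM P hP γ hγ ((le_max_right _ _).trans_lt hlt) hcon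
  rw [inv_inv] at ht
  rw [ht.unique hP (HasValue.xcoord P i)] at htM
  exact absurd ((le_max_left _ _).trans_lt hlt) (not_lt.2 htM)

/-- If the function `a + b√d` has norm and trace minus one vanishing at infinity, then the
coordinates of rational points are bounded for each absolute value invariant under
conjugation. -/
lemma exists_bound_of_invariant {L : Type*} [Field L] [Algebra K L] (w : AbsoluteValue L ℝ)
    (τ : L ≃ₐ[K] L) (hw : ∀ x, w (τ x) = w x) {θ : L} {d : K} (hθ : θ ^ 2 = algebraMap K L d)
    (hτ : τ θ = -θ) {a b : C.FunField}
    (hab : ∀ (V : ValuationSubring C.FunField) (i : Fin n),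
      (∀ c : K, algebraMap K C.FunField c ∈ V) → C.xcoord i ∉ V →
        a ^ 2 - algebraMap K C.FunField d * b ^ 2 ∈ V.nonunits ∧ 2 * a - 1 ∈ V.nonunits) :
    ∃ M : ℝ, ∀ P, C.OnCurve P → (∃ α, C.HasValue P a α) → (∃ β, C.HasValue P b β) →
      ∀ i, w (algebraMap K L (P i)) ≤ M := by
  let w' : AbsoluteValue K ℝ := w.comp (algebraMap K L).injective
  have hex (i : Fin n) : ∃ M : ℝ, ∀ P, C.OnCurve P → (∃ α, C.HasValue P a α) →
      (∃ β, C.HasValue P b β) → w' (P i) ≤ M := by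
    obtain ⟨M, hM⟩ := C.exists_bound_of_mem_nonunits w' i (fun V hV hi => (hab V i hV hi).1)
      (show (0 : ℝ) < 1 / 16 by norm_num)
    obtain ⟨M', hM'⟩ := C.exists_bound_of_mem_nonunits w' i (fun V hV hi => (hab V i hV hi).2)
      (show (0 : ℝ) < 1 / 2 by norm_num)
    refine ⟨max M M', fun P hP ⟨α, hα⟩ ⟨β, hβ⟩ => ?_⟩
    by_contra! hlt
    have hnorm : C.HasValue P (a ^ 2 - algebraMap K C.FunField d * b ^ 2)
        (α ^ 2 - d * β ^ 2) := by
      convert (hα.mul hα).add ((HasValue.const P (-d)).mul (hβ.mul hβ)) using 1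
      · rw [map_neg]
        ring
      · ring
    have htrace : C.HasValue P (2 * a - 1) (2 * α - 1) := by
      convert ((HasValue.const P 2).mul hα).add (HasValue.const P (-1)) using 1
      · rw [map_neg, map_ofNat, map_one]
        ring
      · ring
    have h1 : w (algebraMap K L (α ^ 2 - d * β ^ 2)) < 1 / 16 :=
      hM P hP _ hnorm ((le_max_left _ _).trans_lt hlt)
    have h2 : w (algebraMap K L (2 * α - 1)) < 1 / 2 :=
      hM' P hP _ htrace ((le_max_right _ _).trans_lt hlt)
    set u := algebraMap K L α + algebraMap K L β * θ with hu
    have hτu : τ u = algebraMap K L α - algebraMap K L β * θ := by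
      simp [hu, hτ, sub_eq_add_neg]
    have h3 : algebraMap K L (α ^ 2 - d * β ^ 2) = u * τ u := by
      rw [hτu]
      simp only [hu, map_sub, map_mul, map_pow, ← hθ]
      ring
    have h4 : (1 : L) = u + τ u + -algebraMap K L (2 * α - 1) := by
      rw [hτu]
      simp only [hu, map_sub, map_mul, map_ofNat, map_one]
      ring
    rw [h3, map_mul, hw] at h1
    have h5 : w u < 1 / 4 := by nlinarith [w.nonneg u]
    have h6 : w (1 : L) ≤ w u + w (τ u) + w (-algebraMap K L (2 * α - 1)) := by
      conv_lhs => rw [h4]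
      exact (w.add_le _ _).trans (add_le_add_left (w.add_le _ _) _)
    rw [map_one, hw, w.map_neg] at h6
    linarith
  choose M hM using hex
  refine ⟨∑ i, |M i|, fun P hP hα hβ i => (hM i P hP hα hβ).trans ((le_abs_self _).trans ?_)⟩
  exact Finset.single_le_sum (f := fun i => |M i|) (fun _ _ => abs_nonneg _) (Finset.mem_univ i)

/-- The function field is generated by the constants over `K(C)`. -/
lemma adjoin_range_algebraMap_eq_top :
    IntermediateField.adjoin (IntermediateField.adjoin K (Set.range C.xcoord))
      (Set.range (algebraMap (AlgebraicClosure K) C.FunField)) = ⊤ := by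
  set T := IntermediateField.adjoin (IntermediateField.adjoin K (Set.range C.xcoord))
      (Set.range (algebraMap (AlgebraicClosure K) C.FunField))
  have hpoly (f : MvPolynomial (Fin n) (AlgebraicClosure K)) :
      algebraMap C.CoordRing C.FunField (Ideal.Quotient.mk C.idealBar f) ∈ T := by
    induction f using MvPolynomial.induction_on with
    | C c => exact IntermediateField.subset_adjoin _ _ ⟨c, rfl⟩
    | add p q hp hq =>
      rw [map_add, map_add]
      exact add_mem hp hq
    | mul_X p i hp =>
      rw [map_mul, map_mul]
      exact mul_mem hp (T.algebraMap_mem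
        ⟨C.xcoord i, IntermediateField.subset_adjoin _ _ ⟨i, rfl⟩⟩)
  refine eq_top_iff.2 fun x _ => ?_
  obtain ⟨r, s, -, rfl⟩ := IsFractionRing.div_surjective (A := C.CoordRing) x
  obtain ⟨r, rfl⟩ := Ideal.Quotient.mk_surjective r
  obtain ⟨s, rfl⟩ := Ideal.Quotient.mk_surjective s
  exact div_mem (hpoly r) (hpoly s)

end AffineCurve

/-- If `C` has exactly two points at infinity, conjugate over `K` with quadratic field of
definition `L`, and infinitely many `S`-integral points, then some `v ∈ S` splits
in `L`. -/
theorem exists_split_place_of_infinite_SIntegralPoints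
    (K : Type) [Field K] [NumberField K] (n : ℕ) (C : AffineCurve K n)
    (S : Finset (NFPlace K)) (hS : ∀ v : NumberField.InfinitePlace K, Sum.inl v ∈ S)
    (A B : ValuationSubring C.FunField) (hAB : A ≠ B)
    (hinf : ∀ V, C.IsPointAtInfinity V ↔ V = A ∨ V = B)
    (L : IntermediateField K (AlgebraicClosure K)) (hL : Module.finrank K L = 2)
    (hdefA : C.DefinedOver L A) (hdefB : C.DefinedOver L B)
    (hconj : C.ConjugateOverK A B)
    (hinfinite : (C.SIntegralPoints S).Infinite) :
    ∃ v ∈ S, SplitsIn K L v := by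
  have hfd : FiniteDimensional K L := Module.finite_of_finrank_eq_succ hL
  have : NumberField L := NumberField.of_module_finite K L
  obtain ⟨θ, d, τ, hθ, hτ, hgen⟩ := exists_sqrt_generator K L hL
  let E := IntermediateField.adjoin K (Set.range C.xcoord)
  have hxE (i : Fin n) : C.xcoord i ∈ E := IntermediateField.subset_adjoin _ _ ⟨i, rfl⟩
  have : Normal E C.FunField :=
    normal_of_adjoin_range_eq_top (K := K) (Ω := AlgebraicClosure K)
      C.adjoin_range_algebraMap_eq_top
  let θF : C.FunField := C.constMap θ
  have hθF : θF ^ 2 = algebraMap E C.FunField (algebraMap K E d) := by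
    have h := congrArg (fun l : L => C.constMap (l : AlgebraicClosure K)) hθ
    simp only [IntermediateField.coe_pow, map_pow] at h
    exact h
  have hfix (ρ : C.FunField ≃ₐ[E] C.FunField) (hρ : ρ θF = θF) :
      C.FixesLC L (ρ : C.FunField ≃+* C.FunField) := by
    refine ⟨fun l => ?_, fun i => ρ.commutes ⟨_, hxE i⟩⟩
    obtain ⟨p, q, rfl⟩ := hgen l
    have hK (c : K) : ρ (C.constMap (algebraMap K L c)) = C.constMap (algebraMap K L c) :=
      ρ.commutes (algebraMap K E c)
    have hl : C.constMap ((algebraMap K L p + algebraMap K L q * θ : L) : AlgebraicClosure K) =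
        C.constMap (algebraMap K L p) + C.constMap (algebraMap K L q) * θF := by
      simp [θF]
    rw [hl]
    change ρ _ = _
    rw [map_add, map_mul, hK, hK, hρ]
  obtain ⟨σ, ⟨hσK, hσx⟩, hσA, hσB⟩ := hconj
  have hσE (x : E) : σ (algebraMap E C.FunField x) = algebraMap E C.FunField x := by
    obtain ⟨x, hx⟩ := x
    change σ x = x
    induction hx using IntermediateField.adjoin_induction with
    | mem x hx =>
      obtain ⟨i, rfl⟩ := hx
      exact hσx i
    | algebraMap c => exact hσK c
    | add x y _ _ hx hy => rw [map_add, hx, hy]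
    | inv x _ hx => rw [map_inv₀, hx]
    | mul x y _ _ hx hy => rw [map_mul, hx, hy]
  obtain ⟨a, b, ⟨hnA, hnB⟩, htA, htB⟩ := exists_norm_trace_mem_nonunits (E := E) hAB hθF
    (fun ρ hρ => hdefA _ (hfix ρ hρ)) (fun ρ hρ => hdefB _ (hfix ρ hρ))
    (AlgEquiv.ofRingEquiv hσE) hσA hσB
  have hab : ∀ (V : ValuationSubring C.FunField) (i : Fin n),
      (∀ c : K, algebraMap K C.FunField c ∈ V) → C.xcoord i ∉ V →
        (a : C.FunField) ^ 2 - algebraMap K C.FunField d * (b : C.FunField) ^ 2 ∈ V.nonunits ∧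
          2 * (a : C.FunField) - 1 ∈ V.nonunits := by
    intro V i hV hi
    have hplace : C.IsPlace V := by
      refine ⟨fun c => ?_, fun htop => hi (htop ▸ ValuationSubring.mem_top _)⟩
      have hc : IsIntegral K (C.constMap c) := (Algebra.IsIntegral.isIntegral (R := K) c).map
        (IsScalarTower.toAlgHom K (AlgebraicClosure K) C.FunField)
      exact V.mem_of_isIntegral hV hc
    rcases (hinf V).1 ⟨hplace, i, hi⟩ with rfl | rfl
    · exact ⟨hnA, htA⟩
    · exact ⟨hnB, htB⟩
  by_contra! hsplit
  let X := {P ∈ C.SIntegralPoints S |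
    (∃ α, C.HasValue P a α) ∧ ∃ β, C.HasValue P b β}
  have hXfin : X.Finite := by
    refine finite_of_bounded_at_places S X (fun P hP => hP.1.2) (fun v => ?_) (fun v hv => ?_)
    · obtain ⟨w, hw, hwv⟩ := exists_invariant_absoluteValue_infinite τ v (hsplit _ (hS v))
      obtain ⟨M, hM⟩ := C.exists_bound_of_invariant w τ hw hθ hτ hab
      exact ⟨M, fun P hP i => hwv (P i) ▸ hM P hP.1.1 hP.2.1 hP.2.2 i⟩
    · obtain ⟨w, hw, hwv⟩ := exists_invariant_absoluteValue_finite τ v (hsplit _ hv)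
      obtain ⟨M, hM⟩ := C.exists_bound_of_invariant w τ hw hθ hτ hab
      obtain ⟨N, hN, hNM⟩ := hwv M
      exact ⟨N, hN, fun P hP i => hNM _ (hM P hP.1.1 hP.2.1 hP.2.2 i)⟩
  refine hinfinite ((hXfin.union ((C.finite_setOf_not_hasValue a.2).union
    (C.finite_setOf_not_hasValue b.2))).subset fun P hP => ?_)
  by_cases ha : ∃ α, C.HasValue P a α
  · by_cases hb : ∃ β, C.HasValue P b β
    · exact Or.inl ⟨hP, ha, hb⟩
    · exact Or.inr (Or.inr ⟨hP.1, hb⟩)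
  · exact Or.inr (Or.inl ⟨hP.1, ha⟩)
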